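/- Let U ⊆ ℂ^m be an open set, let θ be a holomorphic 1-form on U, and let Φ : D → U be a holomorphic map defined on an open set D ⊆ ℂ × ℂ containing (0,0), with coordinates (t,z). Assume that θ_{Φ(t,z)}(∂Φ/∂z(t,z)) = 0 for all (t,z) ∈ D (i.e., all curves z ↦ Φ(t,z) are integral for the kernel distribution of θ). Define σ(z) := θ_{Φ(0,z)}(∂Φ/∂t(0,z)) and assume σ(0) = 0. Then σ vanishes at 0 with multiplicity at least two (i.e., σ(0) = 0 and the complex derivative of σ at 0 is zero) if and only if dθ_{Φ(0,0)}(∂Φ/∂t(0,0), ∂Φ/∂z(0,0)) = 0. -/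

import Mathlib

open Metric Set Filter Topology

/-- On a disc mapped by a holomorphic `f` into a disc about `f c`, the difference quotients of `f`
at `c` converge to `deriv f c` at an explicit linear rate. -/
theorem Complex.norm_dslope_sub_deriv_le_of_mapsTo_ball {F : Type*} [NormedAddCommGroup F]
    [NormedSpace ℂ F] [CompleteSpace F] {f : ℂ → F} {c z : ℂ} {R₁ R₂ : ℝ}
    (hd : DifferentiableOn ℂ f (ball c R₁)) (h_maps : MapsTo f (ball c R₁) (closedBall (f c) R₂))
    (hz : z ∈ ball c R₁) :
    ‖dslope f c z - deriv f c‖ ≤ 2 * (R₂ / R₁) / R₁ * dist z c := by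
  have hR₁ : 0 < R₁ := nonempty_ball.1 ⟨z, hz⟩
  have hc : c ∈ ball c R₁ := mem_ball_self hR₁
  rw [← dslope_same f c, ← dist_eq_norm]
  refine Complex.dist_le_div_mul_dist_of_mapsTo_ball
    ((Complex.differentiableOn_dslope (ball_mem_nhds c hR₁)).2 hd) (fun w hw ↦ ?_) hz
  rw [mem_closedBall, dist_eq_norm]
  linarith [norm_sub_le (dslope f c w) (dslope f c c),
    Complex.norm_dslope_le_div_of_mapsTo_ball hd h_maps hw,
    Complex.norm_dslope_le_div_of_mapsTo_ball hd h_maps hc]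

theorem DifferentiableAt.hasDerivAt_comp_prodMk_left {𝕜 F : Type*} [NontriviallyNormedField 𝕜]
    [NormedAddCommGroup F] [NormedSpace 𝕜 F] {f : 𝕜 × 𝕜 → F} {t z : 𝕜}
    (hf : DifferentiableAt 𝕜 f (t, z)) :
    HasDerivAt (fun s ↦ f (s, z)) (fderiv 𝕜 f (t, z) (1, 0)) t :=
  hf.hasFDerivAt.comp_hasDerivAt t ((hasDerivAt_id t).prodMk (hasDerivAt_const t z))

theorem DifferentiableAt.hasDerivAt_comp_prodMk_right {𝕜 F : Type*} [NontriviallyNormedField 𝕜]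
    [NormedAddCommGroup F] [NormedSpace 𝕜 F] {f : 𝕜 × 𝕜 → F} {t z : 𝕜}
    (hf : DifferentiableAt 𝕜 f (t, z)) :
    HasDerivAt (fun w ↦ f (t, w)) (fderiv 𝕜 f (t, z) (0, 1)) z :=
  hf.hasFDerivAt.comp_hasDerivAt z ((hasDerivAt_const z t).prodMk (hasDerivAt_id z))

/-- A holomorphic function of two complex variables has mixed second partial derivatives, and
these agree. -/
theorem Complex.exists_hasDerivAt_mixed_partials {F : Type*} [NormedAddCommGroup F]
    [NormedSpace ℂ F] [CompleteSpace F] {f : ℂ × ℂ → F} {D : Set (ℂ × ℂ)}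
    (hf : DifferentiableOn ℂ f D) (hD : IsOpen D) {a b : ℂ} (hab : (a, b) ∈ D) :
    ∃ L : F, HasDerivAt (fun z ↦ fderiv ℂ f (a, z) (1, 0)) L b ∧
      HasDerivAt (fun t ↦ fderiv ℂ f (t, b) (0, 1)) L a := by
  have hdiff : ∀ p ∈ D, DifferentiableAt ℂ f p := fun p hp ↦ hf.differentiableAt (hD.mem_nhds hp)
  obtain ⟨r, hr, hball⟩ : ∃ r > 0, ∀ t ∈ ball a r, ∀ z ∈ ball b r,
      (t, z) ∈ D ∧ dist (f (t, z)) (f (a, b)) < 1 := by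
    have hnear : ∀ᶠ p in 𝓝 (a, b), p ∈ D ∧ dist (f p) (f (a, b)) < 1 :=
      Filter.Eventually.and (hD.mem_nhds hab) ((hdiff _ hab).continuousAt (ball_mem_nhds _ one_pos))
    obtain ⟨r, hr, h⟩ := Metric.eventually_nhds_iff_ball.1 hnear
    exact ⟨r, hr, fun t ht z hz ↦ h (t, z) (by rw [← ball_prod_same]; exact ⟨ht, hz⟩)⟩
  have ha : a ∈ ball a r := mem_ball_self hr
  have hb : b ∈ ball b r := mem_ball_self hr
  have hrate : ∀ t ∈ ball a r, t ≠ a → ∀ z ∈ ball b r,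
      dist (fderiv ℂ f (a, z) (1, 0)) (slope (fun s ↦ f (s, z)) a t)
        ≤ 2 * (2 / r) / r * dist t a := by
    intro t ht hta z hz
    have hd : DifferentiableOn ℂ (fun s ↦ f (s, z)) (ball a r) := fun s hs ↦
      (hdiff _ (hball s hs z hz).1).hasDerivAt_comp_prodMk_left.differentiableAt
        |>.differentiableWithinAt
    have hmaps : MapsTo (fun s ↦ f (s, z)) (ball a r) (closedBall (f (a, z)) 2) := by
      intro s hs
      rw [mem_closedBall]
      linarith [dist_triangle_right (f (s, z)) (f (a, z)) (f (a, b)), (hball s hs z hz).2,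
        (hball a ha z hz).2]
    have h := Complex.norm_dslope_sub_deriv_le_of_mapsTo_ball hd hmaps ht
    rwa [dslope_of_ne _ hta, (hdiff _ (hball a ha z hz).1).hasDerivAt_comp_prodMk_left.deriv,
      ← dist_eq_norm, dist_comm] at h
  have hlim : TendstoLocallyUniformlyOn (fun t z ↦ slope (fun s ↦ f (s, z)) a t)
      (fun z ↦ fderiv ℂ f (a, z) (1, 0)) (𝓝[≠] a) (ball b r) := by
    refine TendstoUniformlyOn.tendstoLocallyUniformlyOn (Metric.tendstoUniformlyOn_iff.2 ?_)
    intro ε hε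
    have hsmall : ∀ᶠ t in 𝓝 a, 2 * (2 / r) / r * dist t a < ε := by
      have hc : ContinuousAt (fun t ↦ 2 * (2 / r) / r * dist t a) a := by fun_prop
      exact hc.eventually_lt continuousAt_const (by simpa using hε)
    filter_upwards [nhdsWithin_le_nhds hsmall, nhdsWithin_le_nhds (ball_mem_nhds a hr),
      self_mem_nhdsWithin] with t h₁ h₂ h₃ z hz
    exact (hrate t h₂ h₃ z hz).trans_lt h₁
  have hslope : ∀ t ∈ ball a r, ∀ z ∈ ball b r,
      HasDerivAt (fun w ↦ slope (fun s ↦ f (s, w)) a t)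
        (slope (fun s ↦ fderiv ℂ f (s, z) (0, 1)) a t) z := by
    intro t ht z hz
    simp only [slope_def_module]
    exact ((hdiff _ (hball t ht z hz).1).hasDerivAt_comp_prodMk_right.sub
      (hdiff _ (hball a ha z hz).1).hasDerivAt_comp_prodMk_right).const_smul _
  have hF : ∀ᶠ t in 𝓝[≠] a, DifferentiableOn ℂ (fun z ↦ slope (fun s ↦ f (s, z)) a t)
      (ball b r) := by
    filter_upwards [nhdsWithin_le_nhds (ball_mem_nhds a hr)] with t ht z hz
    exact (hslope t ht z hz).differentiableAt.differentiableWithinAt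
  refine ⟨_, ((hlim.differentiableOn hF isOpen_ball).differentiableAt
    (ball_mem_nhds b hr)).hasDerivAt, hasDerivAt_iff_tendsto_slope.2 ?_⟩
  refine ((hlim.deriv hF isOpen_ball).tendsto_at hb).congr' ?_
  filter_upwards [nhdsWithin_le_nhds (ball_mem_nhds a hr)] with t ht
  exact (hslope t ht b hb).deriv


/-- Proposition 3.1 of the paper, in a local trivialization.
With `θ`, `Φ`, `σ` as before, assuming `σ(0) = 0`, the section `σ` vanishes at
`0` with multiplicity at least two (i.e. `σ(0) = 0` and `σ'(0) = 0`) if and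
only if `dθ_{Φ(0,0)}(∂Φ/∂t(0,0), ∂Φ/∂z(0,0)) = 0`. -/
theorem stmt1 (m : ℕ) (U : Set (Fin m → ℂ)) (hU : IsOpen U)
    (θ : (Fin m → ℂ) → ((Fin m → ℂ) →L[ℂ] ℂ))
    (hθ : DifferentiableOn ℂ θ U)
    (D : Set (ℂ × ℂ)) (hD : IsOpen D) (h0 : (0, 0) ∈ D)
    (Φ : ℂ × ℂ → (Fin m → ℂ))
    (hΦ : DifferentiableOn ℂ Φ D)
    (hΦU : ∀ p ∈ D, Φ p ∈ U)
    (hint : ∀ p ∈ D, θ (Φ p) (fderiv ℂ Φ p (0, 1)) = 0)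
    (σ : ℂ → ℂ)
    (hσ : ∀ z : ℂ, σ z = θ (Φ (0, z)) (fderiv ℂ Φ (0, z) (1, 0)))
    (hσ0 : σ 0 = 0) :
    (σ 0 = 0 ∧ deriv σ 0 = 0) ↔
      (fderiv ℂ θ (Φ (0, 0)) (fderiv ℂ Φ (0, 0) (1, 0))) (fderiv ℂ Φ (0, 0) (0, 1))
        - (fderiv ℂ θ (Φ (0, 0)) (fderiv ℂ Φ (0, 0) (0, 1))) (fderiv ℂ Φ (0, 0) (1, 0)) = 0 := by
  have hΦ₀ : DifferentiableAt ℂ Φ (0, 0) := hΦ.differentiableAt (hD.mem_nhds h0)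
  have hθ₀ : HasFDerivAt θ (fderiv ℂ θ (Φ (0, 0))) (Φ (0, 0)) :=
    (hθ.differentiableAt (hU.mem_nhds (hΦU _ h0))).hasFDerivAt
  obtain ⟨L, hz, ht⟩ := Complex.exists_hasDerivAt_mixed_partials hΦ hD h0
  have hσ' : HasDerivAt σ
      (fderiv ℂ θ (Φ (0, 0)) (fderiv ℂ Φ (0, 0) (0, 1)) (fderiv ℂ Φ (0, 0) (1, 0))
        + θ (Φ (0, 0)) L) 0 := by
    rw [funext hσ]
    have hθz := hθ₀.comp_hasDerivAt (0 : ℂ) hΦ₀.hasDerivAt_comp_prodMk_right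
    exact hθz.clm_apply hz
  have hint' : HasDerivAt (fun t : ℂ ↦ θ (Φ (t, 0)) (fderiv ℂ Φ (t, 0) (0, 1)))
      (fderiv ℂ θ (Φ (0, 0)) (fderiv ℂ Φ (0, 0) (1, 0)) (fderiv ℂ Φ (0, 0) (0, 1))
        + θ (Φ (0, 0)) L) 0 := by
    have hθt := hθ₀.comp_hasDerivAt (0 : ℂ) hΦ₀.hasDerivAt_comp_prodMk_left
    exact hθt.clm_apply ht
  have hzero : (fun t : ℂ ↦ θ (Φ (t, 0)) (fderiv ℂ Φ (t, 0) (0, 1))) =ᶠ[𝓝 0] fun _ ↦ 0 := by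
    have hc : ContinuousAt (fun t : ℂ ↦ (t, (0 : ℂ))) 0 := by fun_prop
    filter_upwards [hc (hD.mem_nhds h0)] with t ht
    exact hint _ ht
  have hsum := hint'.unique ((hasDerivAt_const (0 : ℂ) (0 : ℂ)).congr_of_eventuallyEq hzero)
  rw [and_iff_right hσ0, hσ'.deriv, ← neg_eq_zero]
  refine Eq.congr_left ?_
  linear_combination -hsum
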